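/- arXiv:1109.1349 — 2 statements merged into one kernel-verified Lean document; each statement's English description precedes it below -/
import Mathlib

section
/- For a bipartite quantum state ρ_AB on H_A ⊗ H_B, if ρ_AB is separable (a convex combination of product states), then its partial transpose with respect to system B is positive semidefinite. -/
open Matrix Kronecker
open scoped ComplexOrder

/-- Partial transpose with respect to the second (B) factor:
`⟨i,j|ρ^{T_B}|k,l⟩ = ⟨i,l|ρ|k,j⟩`. -/
def ptransposeB {a b : Type*} [Fintype a] [Fintype b]
    (ρ : Matrix (a × b) (a × b) ℂ) : Matrix (a × b) (a × b) ℂ :=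
  fun p q => ρ (p.1, q.2) (q.1, p.2)

/-- ρ_AB is separable: a convex combination of tensor products of density operators. -/
def SeparableState {a b : Type*} [Fintype a] [Fintype b]
    (ρ : Matrix (a × b) (a × b) ℂ) : Prop :=
  ∃ (n : ℕ) (p : Fin n → ℝ) (ρA : Fin n → Matrix a a ℂ) (ρB : Fin n → Matrix b b ℂ),
    (∀ i, 0 ≤ p i) ∧ (∑ i, p i = 1) ∧
    (∀ i, (ρA i).PosSemidef ∧ (ρA i).trace = 1) ∧
    (∀ i, (ρB i).PosSemidef ∧ (ρB i).trace = 1) ∧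
    ρ = ∑ i, (p i : ℂ) • (ρA i ⊗ₖ ρB i)

theorem ptransposeB_sum_smul_kronecker {a b ι : Type*} [Fintype a] [Fintype b] [Fintype ι]
    (c : ι → ℂ) (A : ι → Matrix a a ℂ) (B : ι → Matrix b b ℂ) :
    ptransposeB (∑ i, c i • (A i ⊗ₖ B i)) = ∑ i, c i • (A i ⊗ₖ (B i)ᵀ) := by
  ext p q
  simp [ptransposeB, Matrix.sum_apply]

/-- A separable bipartite density operator has positive semidefinite partial transpose. -/
theorem separable_implies_ppt {a b : Type*} [Fintype a] [Fintype b]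
    [DecidableEq a] [DecidableEq b]
    (ρ : Matrix (a × b) (a × b) ℂ) (hρ : ρ.PosSemidef) (htr : ρ.trace = 1)
    (hsep : SeparableState ρ) : (ptransposeB ρ).PosSemidef := by
  obtain ⟨n, p, ρA, ρB, hp, -, hA, hB, rfl⟩ := hsep
  rw [ptransposeB_sum_smul_kronecker]
  exact posSemidef_sum _ fun i _ =>
    ((hA i).1.kronecker (hB i).1.transpose).smul (Complex.zero_le_real.mpr (hp i))
end

section
/- If a bipartite density operator ρ_AB on H_A ⊗ H_B satisfies the reduction criterion ρ_A ⊗ I_B ≥ ρ_AB, then the spectrum of ρ_AB is majorized by the spectrum of the reduced state ρ_A. -/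
open Matrix Kronecker
open scoped ComplexOrder

/-- Partial trace over the second (B) factor. -/
noncomputable def ptraceB {a b : Type*} [Fintype a] [Fintype b]
    (ρ : Matrix (a × b) (a × b) ℂ) : Matrix a a ℂ :=
  fun i k => ∑ j : b, ρ (i, j) (k, j)

/-- `x` majorizes `y` (vectors over possibly different finite index sets, compared after
padding with zeros): total sums agree, and every partial sum of `y` over a set `B` is
dominated by a partial sum of `x` over a set of at most the same cardinality
(for nonnegative vectors this is exactly padded majorization). -/
def Majorizes {ι κ : Type*} [Fintype ι] [Fintype κ] (x : ι → ℝ) (y : κ → ℝ) : Prop :=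
  (∑ i, x i = ∑ j, y j) ∧
  ∀ B : Finset κ, ∃ A : Finset ι, A.card ≤ B.card ∧ ∑ j ∈ B, y j ≤ ∑ i ∈ A, x i

/-- If `w` takes values in `[0, 1]` and has total mass at most `k`, then the `w`-weighted sum of a
nonnegative family is at most a sum of at most `k` of its members. -/
theorem exists_card_le_sum_mul_le {ι : Type*} [Fintype ι] (p w : ι → ℝ) (k : ℕ)
    (hp : ∀ i, 0 ≤ p i) (hw0 : ∀ i, 0 ≤ w i) (hw1 : ∀ i, w i ≤ 1) (hwk : ∑ i, w i ≤ k) :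
    ∃ A : Finset ι, A.card ≤ k ∧ ∑ i, p i * w i ≤ ∑ i ∈ A, p i := by
  classical
  rcases le_total (Fintype.card ι) k with hk | hk
  · exact ⟨Finset.univ, hk, Finset.sum_le_sum fun i _ => mul_le_of_le_one_right (hp i) (hw1 i)⟩
  obtain ⟨A, hA, hmax⟩ := Finset.exists_max_image (Finset.powersetCard k Finset.univ)
    (fun A : Finset ι => ∑ i ∈ A, p i) (Finset.powersetCard_nonempty.2 hk)
  replace hA := (Finset.mem_powersetCard.1 hA).2
  refine ⟨A, hA.le, ?_⟩
  obtain ⟨t, ht, htA, htA'⟩ : ∃ t : ℝ, 0 ≤ t ∧ (∀ i ∈ A, t ≤ p i) ∧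
      ∀ i ∉ A, p i * w i ≤ t * w i := by
    rcases A.eq_empty_or_nonempty with rfl | hne
    · have hk0 : k = 0 := by simpa using hA.symm
      subst hk0
      have h0 : ∀ i, w i = 0 := fun i => le_antisymm
        ((Finset.single_le_sum (fun i _ => hw0 i) (Finset.mem_univ i)).trans (by simpa using hwk))
        (hw0 i)
      exact ⟨0, le_rfl, by simp, by simp [h0]⟩
    · obtain ⟨m, hm, hmin⟩ := A.exists_min_image p hne
      refine ⟨p m, hp m, hmin, fun i hi => mul_le_mul_of_nonneg_right ?_ (hw0 i)⟩
      have hi' : i ∉ A.erase m := fun h => hi (Finset.mem_of_mem_erase h)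
      have := hmax (insert i (A.erase m)) (by
        rw [Finset.mem_powersetCard, Finset.card_insert_of_notMem hi',
          Finset.card_erase_add_one hm]
        exact ⟨Finset.subset_univ _, hA⟩)
      rw [Finset.sum_insert hi', ← Finset.add_sum_erase A p hm] at this
      linarith
  have key : ∀ i, p i * w i ≤ t * w i + if i ∈ A then p i - t else 0 := by
    intro i
    split_ifs with hi
    · nlinarith [htA i hi, hw1 i]
    · simpa using htA' i hi
  calc ∑ i, p i * w i ≤ ∑ i, (t * w i + if i ∈ A then p i - t else 0) :=
        Finset.sum_le_sum fun i _ => key i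
    _ = t * (∑ i, w i - k) + ∑ i ∈ A, p i := by
        rw [Finset.sum_add_distrib, ← Finset.mul_sum, Finset.sum_ite_mem, Finset.univ_inter,
          Finset.sum_sub_distrib, Finset.sum_const, hA, nsmul_eq_mul]
        ring
    _ ≤ ∑ i ∈ A, p i := by nlinarith

/-- If `p` and `l` are linked by nonnegative weights `N` with unit row sums whose `l`-weighted
column sums are `p`, and `l j * ∑ i, N j i / p i ≤ 1`, then `p` majorizes `l`. -/
theorem majorizes_of_weights {ι κ : Type*} [Fintype ι] [Fintype κ] (p : ι → ℝ) (l : κ → ℝ)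
    (N : κ → ι → ℝ) (hl : ∀ j, 0 ≤ l j) (hN : ∀ j i, 0 ≤ N j i)
    (hrow : ∀ j, ∑ i, N j i = 1) (hcol : ∀ i, ∑ j, l j * N j i = p i)
    (hle : ∀ j, l j * ∑ i, N j i * (p i)⁻¹ ≤ 1) : Majorizes p l := by
  have hp : ∀ i, 0 ≤ p i := fun i =>
    hcol i ▸ Finset.sum_nonneg fun j _ => mul_nonneg (hl j) (hN j i)
  refine ⟨?_, fun B => ?_⟩
  · simp_rw [← hcol]
    rw [Finset.sum_comm]
    simp_rw [← Finset.mul_sum, hrow, mul_one]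
  have hD : ∀ j i, 0 ≤ l j * N j i * (p i)⁻¹ := fun j i =>
    mul_nonneg (mul_nonneg (hl j) (hN j i)) (inv_nonneg.2 (hp i))
  obtain ⟨A, hA, hAB⟩ := exists_card_le_sum_mul_le p
    (fun i => ∑ j ∈ B, l j * N j i * (p i)⁻¹) B.card hp
    (fun i => Finset.sum_nonneg fun j _ => hD j i)
    (fun i => by
      calc ∑ j ∈ B, l j * N j i * (p i)⁻¹ ≤ ∑ j, l j * N j i * (p i)⁻¹ :=
            Finset.sum_le_univ_sum_of_nonneg fun j => hD j i
        _ = p i * (p i)⁻¹ := by rw [← Finset.sum_mul, hcol]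
        _ ≤ 1 := mul_inv_le_one)
    (by
      rw [Finset.sum_comm]
      calc ∑ j ∈ B, ∑ i, l j * N j i * (p i)⁻¹ ≤ ∑ j ∈ B, (1 : ℝ) :=
            Finset.sum_le_sum fun j _ => by simpa only [mul_assoc, ← Finset.mul_sum] using hle j
        _ = B.card := by simp)
  refine ⟨A, hA, le_trans (le_of_eq ?_) hAB⟩
  simp_rw [Finset.mul_sum]
  rw [Finset.sum_comm]
  refine Finset.sum_congr rfl fun j _ => ?_
  trans ∑ i, l j * N j i
  · rw [← Finset.mul_sum, hrow, mul_one]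
  refine Finset.sum_congr rfl fun i _ => ?_
  by_cases hpi : p i = 0
  · have h0 := (Finset.sum_eq_zero_iff_of_nonneg fun j _ => mul_nonneg (hl j) (hN j i)).1
      ((hcol i).trans hpi) j (Finset.mem_univ j)
    rw [h0, hpi]
    simp
  · field_simp

/-- If `V * diagonal l * Vᴴ ≤ diagonal q`, then each column `v` of `V` satisfies
`l j * ⟪v, (diagonal q)⁻¹ v⟫ ≤ 1`, with the convention `0⁻¹ = 0`. -/
theorem mul_sum_normSq_mul_inv_le_one {m n : Type*} [Fintype m] [Fintype n] [DecidableEq m]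
    [DecidableEq n] (V : Matrix m n ℂ) (q : m → ℝ) (l : n → ℝ) (hq : ∀ x, 0 ≤ q x)
    (hl : ∀ j, 0 ≤ l j)
    (h : (diagonal (fun x => (q x : ℂ)) - V * diagonal (fun j => (l j : ℂ)) * Vᴴ).PosSemidef)
    (j : n) : l j * ∑ x, Complex.normSq (V x j) * (q x)⁻¹ ≤ 1 := by
  set D := diagonal (fun x => (q x : ℂ)) with hD
  set L := diagonal (fun j => (l j : ℂ)) with hL
  set D' := diagonal (fun x => ((q x)⁻¹ : ℂ)) with hD'
  set G := Vᴴ * D' * V with hG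
  set s := ∑ x, Complex.normSq (V x j) * (q x)⁻¹ with hs
  have hD'H : D'ᴴ = D' := by
    rw [hD', diagonal_conjTranspose]
    congr 1
    ext x
    simp
  have hGH : Gᴴ = G := by
    rw [hG, conjTranspose_mul, conjTranspose_mul, conjTranspose_conjTranspose, hD'H,
      Matrix.mul_assoc]
  have hDDD : D' * D * D' = D' := by
    simp only [hD', hD, diagonal_mul_diagonal]
    congr 1
    ext x
    by_cases hx : (q x : ℂ) = 0
    · simp [hx]
    · field_simp
  have hconj : (D' * V)ᴴ * (D - V * L * Vᴴ) * (D' * V) = G - G * L * Gᴴ := by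
    rw [hGH, conjTranspose_mul, hD'H, Matrix.mul_sub, Matrix.sub_mul, hG]
    congr 1
    · calc Vᴴ * D' * D * (D' * V) = Vᴴ * (D' * D * D') * V := by simp only [Matrix.mul_assoc]
        _ = _ := by rw [hDDD]
    · simp only [Matrix.mul_assoc]
  have hGjj : G j j = (s : ℂ) := by
    rw [hG, hs, Matrix.mul_apply]
    push_cast
    refine Finset.sum_congr rfl fun x _ => ?_
    rw [hD', mul_diagonal, conjTranspose_apply, Complex.normSq_eq_conj_mul_self, starRingEnd_apply]
    ring
  have hGLG : (G * L * Gᴴ) j j = ((∑ k, l k * Complex.normSq (G j k) : ℝ) : ℂ) := by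
    rw [Matrix.mul_apply]
    push_cast
    refine Finset.sum_congr rfl fun k _ => ?_
    rw [hL, mul_diagonal, conjTranspose_apply, Complex.normSq_eq_conj_mul_self, starRingEnd_apply]
    ring
  have hnn := (h.conjTranspose_mul_mul_same (D' * V)).diag_nonneg (i := j)
  rw [hconj, Matrix.sub_apply, hGjj, hGLG, ← Complex.ofReal_sub, Complex.zero_le_real] at hnn
  have hterm : l j * (s * s) ≤ ∑ k, l k * Complex.normSq (G j k) := by
    have := Finset.single_le_sum (f := fun k => l k * Complex.normSq (G j k))
      (fun k _ => mul_nonneg (hl k) (Complex.normSq_nonneg _)) (Finset.mem_univ j)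
    simpa only [hGjj, Complex.normSq_ofReal] using this
  have hs0 : 0 ≤ s :=
    Finset.sum_nonneg fun x _ => mul_nonneg (Complex.normSq_nonneg _) (inv_nonneg.2 (hq x))
  rcases hs0.eq_or_lt with h0 | hpos
  · rw [← h0]
    simp
  · by_contra! hlt
    nlinarith

theorem ptraceB_conjTranspose_mul_mul_kronecker_one {a b : Type*} [Fintype a] [Fintype b]
    [DecidableEq b] (U : Matrix a a ℂ) (ρ : Matrix (a × b) (a × b) ℂ) :
    ptraceB ((U ⊗ₖ (1 : Matrix b b ℂ))ᴴ * ρ * (U ⊗ₖ (1 : Matrix b b ℂ))) =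
      Uᴴ * ptraceB ρ * U := by
  ext i k
  simp only [ptraceB, Matrix.mul_apply, conjTranspose_apply, kronecker_apply, Matrix.one_apply,
    Fintype.sum_prod_type, mul_ite, mul_one, mul_zero, apply_ite star, star_zero, ite_mul, zero_mul,
    Finset.sum_ite_eq', Finset.mem_univ, if_true, Finset.mul_sum]
  rw [Finset.sum_comm]
  refine Finset.sum_congr rfl fun c _ => ?_
  simp only [Finset.sum_mul]
  rw [Finset.sum_comm]

theorem Matrix.IsHermitian.eq_mul_diagonal_mul {n : Type*} [Fintype n] [DecidableEq n]
    {A : Matrix n n ℂ} (hA : A.IsHermitian) :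
    A = (hA.eigenvectorUnitary : Matrix n n ℂ) * diagonal (fun i => (hA.eigenvalues i : ℂ)) *
      (hA.eigenvectorUnitary : Matrix n n ℂ)ᴴ :=
  hA.spectral_theorem

/-- Hiroshima: if ρ_AB satisfies the A-side reduction criterion ρ_A ⊗ I_B ≥ ρ_AB,
then the spectrum of ρ_A majorizes the spectrum of ρ_AB. -/
theorem reduction_implies_majorization {a b : Type*} [Fintype a] [Fintype b]
    [DecidableEq a] [DecidableEq b]
    (ρ : Matrix (a × b) (a × b) ℂ) (hρ : ρ.PosSemidef) (htr : ρ.trace = 1)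
    (hA : (ptraceB ρ).IsHermitian)
    (hred : ((ptraceB ρ) ⊗ₖ (1 : Matrix b b ℂ) - ρ).PosSemidef) :
    Majorizes hA.eigenvalues hρ.1.eigenvalues := by
  have hspecA := hA.eq_mul_diagonal_mul
  have hspec := hρ.1.eq_mul_diagonal_mul
  have hl := hρ.eigenvalues_nonneg
  set U := hA.eigenvectorUnitary.val
  set E := hρ.1.eigenvectorUnitary.val
  have hUU : Uᴴ * U = 1 := Unitary.coe_star_mul_self hA.eigenvectorUnitary
  have hUU' : U * Uᴴ = 1 := mul_eq_one_comm.1 hUU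
  have hEE : Eᴴ * E = 1 := Unitary.coe_star_mul_self hρ.1.eigenvectorUnitary
  generalize hA.eigenvalues = p at *
  generalize hρ.1.eigenvalues = l at *
  set P := diagonal (fun i => (p i : ℂ)) with hP
  set L := diagonal (fun j => (l j : ℂ)) with hL
  set W := U ⊗ₖ (1 : Matrix b b ℂ) with hW
  set V := Wᴴ * E with hV
  have hWH : Wᴴ = Uᴴ ⊗ₖ (1 : Matrix b b ℂ) := by
    rw [hW, conjTranspose_kronecker, conjTranspose_one]
  have hVV : Vᴴ * V = 1 := by
    have hWW : W * Wᴴ = 1 := by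
      rw [hWH, hW, ← mul_kronecker_mul, hUU', Matrix.mul_one, one_kronecker_one]
    calc Vᴴ * V = Eᴴ * (W * Wᴴ) * E := by
          rw [hV, conjTranspose_mul, conjTranspose_conjTranspose]
          simp only [Matrix.mul_assoc]
      _ = 1 := by rw [hWW, Matrix.mul_one, hEE]
  have hσ : Wᴴ * ρ * W = V * L * Vᴴ := by
    rw [hspec, hV, conjTranspose_mul, conjTranspose_conjTranspose]
    simp only [Matrix.mul_assoc]
  have hUP : Uᴴ * ptraceB ρ * U = P := by
    calc Uᴴ * ptraceB ρ * U = (Uᴴ * U) * P * (Uᴴ * U) := by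
          rw [hspecA]
          simp only [Matrix.mul_assoc]
      _ = P := by rw [hUU, Matrix.one_mul, Matrix.mul_one]
  have hPσ : ptraceB (V * L * Vᴴ) = P := by
    rw [← hσ, ptraceB_conjTranspose_mul_mul_kronecker_one, hUP]
  have hpsd : (diagonal (fun x : a × b => (p x.1 : ℂ)) - V * L * Vᴴ).PosSemidef := by
    have := hred.conjTranspose_mul_mul_same W
    rw [Matrix.mul_sub, Matrix.sub_mul, hσ, hWH, hW, ← mul_kronecker_mul, ← mul_kronecker_mul, hUP,
      Matrix.mul_one, Matrix.mul_one, hP, ← diagonal_one, diagonal_kronecker_diagonal] at this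
    simpa only [mul_one] using this
  have hcol : ∀ i, ∑ j, l j * ∑ c, Complex.normSq (V (i, c) j) = p i := by
    intro i
    have := congrFun (congrFun hPσ i) i
    rw [hP, diagonal_apply_eq] at this
    apply Complex.ofReal_injective
    rw [← this]
    have hentry : ∀ x, (V * L * Vᴴ) x x = ∑ j, V x j * (l j : ℂ) * star (V x j) := fun x => by
      rw [Matrix.mul_apply]
      simp only [hL, mul_diagonal, conjTranspose_apply]
    simp only [ptraceB, hentry]
    rw [Finset.sum_comm]
    push_cast
    refine Finset.sum_congr rfl fun j _ => ?_
    rw [Finset.mul_sum]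
    refine Finset.sum_congr rfl fun c _ => ?_
    rw [Complex.normSq_eq_conj_mul_self, starRingEnd_apply]
    ring
  have hN : ∀ j i, 0 ≤ ∑ c, Complex.normSq (V (i, c) j) := fun j i =>
    Finset.sum_nonneg fun c _ => Complex.normSq_nonneg _
  have hp : ∀ i, 0 ≤ p i := fun i =>
    hcol i ▸ Finset.sum_nonneg fun j _ => mul_nonneg (hl j) (hN j i)
  refine majorizes_of_weights p l (fun j i => ∑ c, Complex.normSq (V (i, c) j)) hl hN ?_ hcol ?_
  · intro j
    have := congrFun (congrFun hVV j) j
    rw [Matrix.one_apply_eq, Matrix.mul_apply, Fintype.sum_prod_type] at this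
    apply Complex.ofReal_injective
    rw [Complex.ofReal_one, ← this]
    push_cast
    simp only [Complex.normSq_eq_conj_mul_self, starRingEnd_apply, conjTranspose_apply]
  · intro j
    have := mul_sum_normSq_mul_inv_le_one V (fun x => p x.1) l (fun x => hp x.1) hl hpsd j
    simpa only [Fintype.sum_prod_type, ← Finset.sum_mul] using this
end
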